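/- arXiv:quant-ph/0411036 — 11 statements merged into one kernel-verified Lean document; each statement's English description precedes it below -/
import Mathlib

section
/- For every real x, with ρ(x) the 2×2 real matrix with entries ρ₀₀ = (1+x)/2, ρ₀₁ = ρ₁₀ = x/2, ρ₁₁ = (1−x)/2, one has (1/8)·[ ∑_{a,b ∈ S} ∏_{i=0}^{6} ρ(x)_{a(i),b(i)} + ∑_{a,b ∈ S} ∏_{i=0}^{6} ρ(x)_{1−a(i),1−b(i)} ] = (1 + 14x⁴)/64. (This is the acceptance probability of the Steane-code magic state distillation procedure applied to seven copies of the state with Bloch vector (x,0,x).) -/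
/-- The even-weight codewords of the classical [7,4] Hamming code
(the Z-type codeword set of the Steane code). -/
def S : Finset (Fin 7 → ZMod 2) :=
  { ![0,0,0,0,0,0,0], ![0,0,0,1,1,1,1], ![0,1,1,0,0,1,1], ![0,1,1,1,1,0,0],
    ![1,0,1,0,1,0,1], ![1,0,1,1,0,1,0], ![1,1,0,0,1,1,0], ![1,1,0,1,0,0,1] }

/-- Density matrix of the single-qubit state with Bloch vector `(x, 0, x)`. -/
noncomputable def rho (x : ℝ) : Matrix (ZMod 2) (ZMod 2) ℝ := fun i j =>
  if i = 0 then (if j = 0 then (1 + x) / 2 else x / 2)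
  else (if j = 0 then x / 2 else (1 - x) / 2)

theorem sum_S_aux (f : (Fin 7 → ZMod 2) → ℝ) : ∑ a ∈ S, f a =
    f ![0,0,0,0,0,0,0] + (f ![0,0,0,1,1,1,1] + (f ![0,1,1,0,0,1,1] + (f ![0,1,1,1,1,0,0] +
    (f ![1,0,1,0,1,0,1] + (f ![1,0,1,1,0,1,0] + (f ![1,1,0,0,1,1,0] + f ![1,1,0,1,0,0,1])))))) := by
  unfold S
  rw [Finset.sum_insert (by decide), Finset.sum_insert (by decide), Finset.sum_insert (by decide),
    Finset.sum_insert (by decide), Finset.sum_insert (by decide), Finset.sum_insert (by decide),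
    Finset.sum_insert (by decide), Finset.sum_singleton]

theorem rho00_aux (x : ℝ) : rho x 0 0 = (1 + x) / 2 := by simp [rho]
theorem rho01_aux (x : ℝ) : rho x 0 1 = x / 2 := by simp [rho]
theorem rho10_aux (x : ℝ) : rho x 1 0 = x / 2 := by simp [rho]
theorem rho11_aux (x : ℝ) : rho x 1 1 = (1 - x) / 2 := by simp [rho]

set_option maxHeartbeats 4000000 in
theorem stmt_3 (x : ℝ) :
    (1 / 8 : ℝ) *
      ((∑ a ∈ S, ∑ b ∈ S, ∏ i : Fin 7, rho x (a i) (b i)) +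
       (∑ a ∈ S, ∑ b ∈ S, ∏ i : Fin 7, rho x (1 - a i) (1 - b i))) =
      (1 + 14 * x ^ 4) / 64 := by
  simp only [sum_S_aux, Fin.prod_univ_seven, Matrix.cons_val, sub_zero, sub_self,
    rho00_aux, rho01_aux, rho10_aux, rho11_aux]
  ring
end

section
/- For every real x, with ρ(x) the 2×2 real matrix with entries ρ₀₀ = (1+x)/2, ρ₀₁ = ρ₁₀ = x/2, ρ₁₁ = (1−x)/2, one has (1/8)·∑_{a,b ∈ S} ∏_{i=0}^{6} ρ(x)_{a(i), 1−b(i)} = x³(7 + 8x⁴)/128. Consequently, whenever 1 + 14x⁴ ≠ 0, the ratio of twice this off-diagonal matrix element to the acceptance probability (1+14x⁴)/64 equals x³(7+8x⁴)/(1+14x⁴); i.e., the output Bloch coordinate of the distillation is x_out = x³(7+8x⁴)/(1+14x⁴). -/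
theorem S_sum (f : (Fin 7 → ZMod 2) → ℝ) : ∑ a ∈ S, f a =
    f ![0,0,0,0,0,0,0] + f ![0,0,0,1,1,1,1] + f ![0,1,1,0,0,1,1] + f ![0,1,1,1,1,0,0] +
    f ![1,0,1,0,1,0,1] + f ![1,0,1,1,0,1,0] + f ![1,1,0,0,1,1,0] + f ![1,1,0,1,0,0,1] := by
  unfold S
  repeat rw [Finset.sum_insert (by decide)]
  rw [Finset.sum_singleton]
  ring

theorem prod_seven (x : ℝ) (a b : Fin 7 → ZMod 2) : ∏ i : Fin 7, rho x (a i) (1 - b i) =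
    rho x (a 0) (1 - b 0) * rho x (a 1) (1 - b 1) * rho x (a 2) (1 - b 2) *
    rho x (a 3) (1 - b 3) * rho x (a 4) (1 - b 4) * rho x (a 5) (1 - b 5) *
    rho x (a 6) (1 - b 6) := Fin.prod_univ_seven _

theorem main_sum (x : ℝ) :
    (1 / 8 : ℝ) * (∑ a ∈ S, ∑ b ∈ S, ∏ i : Fin 7, rho x (a i) (1 - b i)) =
      x ^ 3 * (7 + 8 * x ^ 4) / 128 := by
  have h00 : rho x 0 (1 - 0) = x / 2 := by simp [rho]
  have h01 : rho x 0 (1 - 1) = (1 + x) / 2 := by simp [rho]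
  have h10 : rho x 1 (1 - 0) = (1 - x) / 2 := by simp [rho]
  have h11 : rho x 1 (1 - 1) = x / 2 := by simp [rho]
  have e (c0 c1 c2 c3 c4 c5 c6 : ZMod 2) : (![c0,c1,c2,c3,c4,c5,c6] 0 = c0) ∧
      (![c0,c1,c2,c3,c4,c5,c6] 1 = c1) ∧ (![c0,c1,c2,c3,c4,c5,c6] 2 = c2) ∧
      (![c0,c1,c2,c3,c4,c5,c6] 3 = c3) ∧ (![c0,c1,c2,c3,c4,c5,c6] 4 = c4) ∧
      (![c0,c1,c2,c3,c4,c5,c6] 5 = c5) ∧ (![c0,c1,c2,c3,c4,c5,c6] 6 = c6) :=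
    ⟨rfl, rfl, rfl, rfl, rfl, rfl, rfl⟩
  simp only [S_sum, prod_seven, e, h00, h01, h10, h11]
  ring

theorem stmt_4 (x : ℝ) :
    (1 / 8 : ℝ) * (∑ a ∈ S, ∑ b ∈ S, ∏ i : Fin 7, rho x (a i) (1 - b i)) =
      x ^ 3 * (7 + 8 * x ^ 4) / 128 ∧
    (1 + 14 * x ^ 4 ≠ 0 →
      2 * ((1 / 8 : ℝ) * (∑ a ∈ S, ∑ b ∈ S, ∏ i : Fin 7, rho x (a i) (1 - b i))) /
          ((1 + 14 * x ^ 4) / 64) =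
        x ^ 3 * (7 + 8 * x ^ 4) / (1 + 14 * x ^ 4)) := by
  refine ⟨main_sum x, fun h => ?_⟩
  rw [main_sum x]
  field_simp
  ring
end

section
/- For every real x with 1/2 < x < 1/√2, one has x < f(x) < 1/√2. (Above the threshold x = 1/2, each round of Steane-code distillation strictly increases the Bloch coordinate toward the H magic state value 1/√2.) -/
/-- The output Bloch coordinate of one round of Steane-code magic state
distillation applied to input Bloch coordinate `x` along the H direction. -/
noncomputable def f (x : ℝ) : ℝ := x ^ 3 * (7 + 8 * x ^ 4) / (1 + 14 * x ^ 4)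

theorem stmt_6 (x : ℝ) (h1 : 1 / 2 < x) (h2 : x < 1 / Real.sqrt 2) :
    x < f x ∧ f x < 1 / Real.sqrt 2 := by
  have hr : 0 < Real.sqrt 2 := by positivity
  have hs : Real.sqrt 2 ^ 2 = 2 := Real.sq_sqrt (by norm_num)
  have hx : 0 < x := by linarith
  have ht1 : Real.sqrt 2 * x < 1 := by
    rw [lt_div_iff₀ hr] at h2
    linarith
  obtain ⟨t, ht⟩ : ∃ t, t = Real.sqrt 2 * x := ⟨_, rfl⟩
  rw [← ht] at ht1
  have ht0 : 0 < t := by rw [ht]; positivity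
  have hy : t ^ 2 = 2 * x ^ 2 := by rw [ht, mul_pow, hs]
  have hy2 : x ^ 2 < 1 / 2 := by nlinarith
  have hy1 : 1 / 4 < x ^ 2 := by nlinarith
  have hd : 0 < 1 + 14 * x ^ 4 := by positivity
  unfold f
  constructor
  · rw [lt_div_iff₀ hd]
    have h : 0 < x * ((1 - x ^ 2) * (1 - 2 * x ^ 2) * (4 * x ^ 2 - 1)) := by
      apply mul_pos hx
      apply mul_pos (mul_pos _ _) <;> linarith
    nlinarith [h]
  · rw [div_lt_div_iff₀ hd hr]
    have h : 0 < (1 - t) * ((1 - t ^ 3) ^ 2 + t * (1 - t ^ 2) ^ 2 + t ^ 2 * (1 - t) ^ 2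
        + 7 / 2 * t ^ 3) :=
      mul_pos (by linarith) (by positivity)
    have e4 : x ^ 4 = t ^ 4 / 4 := by
      have : t ^ 4 = (t ^ 2) ^ 2 := by ring
      rw [this, hy]; ring
    have e3 : x ^ 3 * Real.sqrt 2 = t ^ 3 / 2 := by
      have : t ^ 3 = t ^ 2 * t := by ring
      rw [this, hy, ht]; ring
    have e : x ^ 3 * (7 + 8 * x ^ 4) * Real.sqrt 2 = t ^ 3 / 2 * (7 + 2 * t ^ 4) := by
      rw [← e3, e4]; ring
    rw [e, e4]
    nlinarith [h]
end

section
/- For every real x with 0 < x < 1/2, one has 0 < f(x) < x. (Below the threshold x = 1/2, each round of Steane-code distillation strictly decreases the Bloch coordinate.) -/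
theorem stmt_7 (x : ℝ) (h1 : 0 < x) (h2 : x < 1 / 2) :
    0 < f x ∧ f x < x := by
  have hd : 0 < 1 + 14 * x ^ 4 := by positivity
  unfold f
  refine ⟨by positivity, ?_⟩
  rw [div_lt_iff₀ hd]
  have hy : x ^ 2 < 1 / 4 := by nlinarith
  have h3 : 0 < x * ((1 - 4 * x ^ 2) * (1 - 2 * x ^ 2) * (1 - x ^ 2)) := by
    have a : 0 < 1 - 4 * x ^ 2 := by linarith
    have b : 0 < 1 - 2 * x ^ 2 := by linarith
    have c : 0 < 1 - x ^ 2 := by linarith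
    positivity
  linear_combination h3
end

section
/- For every real x₀ with 1/2 < x₀ < 1/√2, the sequence of iterates (f^[n](x₀))_{n∈ℕ} converges to 1/√2. (Repeated Steane-code distillation drives any Bloch coordinate strictly above the threshold 1/2 to the H magic state value 1/√2.) -/
theorem f_sub (x : ℝ) :
    f x - x = x * ((1 - x ^ 2) * (1 - 2 * x ^ 2) * (4 * x ^ 2 - 1)) / (1 + 14 * x ^ 4) := by
  have h : (1 + 14 * x ^ 4) ≠ 0 := by positivity
  unfold f
  field_simp
  ring

theorem f_le (c x : ℝ) (hc : 0 < c) (hc2 : c ^ 2 = 1 / 2) (hx : 0 < x) (hxc : x ≤ c) :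
    f x ≤ c := by
  obtain ⟨t, rfl⟩ : ∃ t, x = c * t := ⟨x / c, by field_simp⟩
  have ht : 0 < t := by
    by_contra h
    nlinarith
  have ht1 : t ≤ 1 := by
    by_contra h
    nlinarith
  unfold f
  rw [div_le_iff₀ (by positivity)]
  have h4 : (c * t) ^ 4 = t ^ 4 / 4 := by
    rw [mul_pow, show c ^ 4 = (c ^ 2) ^ 2 by ring, hc2]; ring
  have h3 : (c * t) ^ 3 = c * (t ^ 3 / 2) := by
    rw [mul_pow, show c ^ 3 = c * c ^ 2 by ring, hc2]; ring
  rw [h4, h3, mul_assoc]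
  apply mul_le_mul_of_nonneg_left _ hc.le
  have h31 : t ^ 3 ≤ 1 := pow_le_one₀ ht.le ht1
  have hq : 0 ≤ 2 + 2 * t + 2 * t ^ 2 - 5 * t ^ 3 + 2 * t ^ 4 + 2 * t ^ 5 + 2 * t ^ 6 := by
    have : 0 ≤ 2 * t ^ 2 * (1 - t) ^ 2 := by positivity
    have : 0 < t ^ 5 := by positivity
    have : 0 < t ^ 6 := by positivity
    nlinarith
  nlinarith [mul_nonneg (sub_nonneg.2 ht1) hq]

theorem stmt_8 (x₀ : ℝ) (h1 : 1 / 2 < x₀) (h2 : x₀ < 1 / Real.sqrt 2) :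
    Filter.Tendsto (fun n => f^[n] x₀) Filter.atTop (nhds (1 / Real.sqrt 2)) := by
  have hc : 0 < 1 / Real.sqrt 2 := by positivity
  have hc2 : (1 / Real.sqrt 2) ^ 2 = 1 / 2 := by
    rw [div_pow, Real.sq_sqrt (by norm_num)]; norm_num
  generalize 1 / Real.sqrt 2 = c at *
  have hge : ∀ x, 1 / 2 ≤ x → x ≤ c → x ≤ f x := by
    intro x hx hxc
    have hx2 : x ^ 2 ≤ 1 / 2 := by rw [← hc2]; gcongr
    have h := f_sub x
    have : 0 ≤ f x - x := by
      rw [h]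
      have a1 : 0 ≤ 1 - x ^ 2 := by linarith
      have a2 : 0 ≤ 1 - 2 * x ^ 2 := by linarith
      have a3 : 0 ≤ 4 * x ^ 2 - 1 := by nlinarith
      have a4 : 0 ≤ x := by linarith
      positivity
    linarith
  have hinv : ∀ n, x₀ ≤ f^[n] x₀ ∧ f^[n] x₀ ≤ c := by
    intro n
    induction n with
    | zero => exact ⟨le_rfl, h2.le⟩
    | succ n ih =>
      rw [Function.iterate_succ_apply']
      exact ⟨ih.1.trans (hge _ (by linarith [ih.1]) ih.2),
        f_le c _ hc hc2 (by linarith [ih.1]) ih.2⟩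
  have hmono : Monotone (fun n => f^[n] x₀) := by
    apply monotone_nat_of_le_succ
    intro n
    rw [Function.iterate_succ_apply']
    exact hge _ (by linarith [(hinv n).1]) (hinv n).2
  have hbdd : BddAbove (Set.range (fun n => f^[n] x₀)) :=
    ⟨c, by rintro _ ⟨n, rfl⟩; exact (hinv n).2⟩
  have hlim := tendsto_atTop_ciSup hmono hbdd
  generalize (⨆ n, f^[n] x₀) = L at hlim
  have hL1 : x₀ ≤ L := ge_of_tendsto' hlim fun n => (hinv n).1
  have hL2 : L ≤ c := le_of_tendsto' hlim fun n => (hinv n).2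
  have hcont : Continuous f := by
    unfold f
    exact Continuous.div (by fun_prop) (by fun_prop) (fun x => by positivity)
  have hfix : f L = L := isFixedPt_of_tendsto_iterate hlim hcont.continuousAt
  have hLc : L = c := by
    by_contra hne
    have hlt : L < c := lt_of_le_of_ne hL2 hne
    have hL0 : 0 < L := by linarith
    have hx2 : L ^ 2 < 1 / 2 := by rw [← hc2]; gcongr
    have h := f_sub L
    have a1 : 0 < 1 - L ^ 2 := by linarith
    have a2 : 0 < 1 - 2 * L ^ 2 := by linarith
    have a3 : 0 < 4 * L ^ 2 - 1 := by nlinarith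
    have : 0 < f L - L := by rw [h]; positivity
    linarith
  rwa [hLc] at hlim
end

section
/- The function f is differentiable at x = 1/√2 with derivative f′(1/√2) = 7/9. (Equivalently, writing p = (1 − √2·x)/2 and p_out = (1 − √2·f(x))/2, in the small-p limit p_out ≈ (7/9)·p, so convergence of the Steane-code distillation is only linear near the magic state.) -/
theorem stmt_9 : HasDerivAt f (7 / 9) (1 / Real.sqrt 2) := by
  have h2 : (1 / Real.sqrt 2) ^ 2 = 1 / 2 := by
    rw [div_pow, Real.sq_sqrt (by norm_num)]; norm_num
  generalize 1 / Real.sqrt 2 = x at h2 ⊢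
  have h4 : x ^ 4 = 1 / 4 := by
    rw [show x ^ 4 = (x ^ 2) ^ 2 by ring, h2]; norm_num
  have h6 : x ^ 6 = 1 / 8 := by
    rw [show x ^ 6 = (x ^ 2) ^ 3 by ring, h2]; norm_num
  have hn : HasDerivAt (fun y : ℝ => y ^ 3 * (7 + 8 * y ^ 4))
      (3 * x ^ 2 * (7 + 8 * x ^ 4) + x ^ 3 * (8 * (4 * x ^ 3))) x := by
    have := (hasDerivAt_pow 3 x).mul (((hasDerivAt_pow 4 x).const_mul 8).const_add 7)
    norm_num at this
    exact this
  have hd : HasDerivAt (fun y : ℝ => 1 + 14 * y ^ 4) (14 * (4 * x ^ 3)) x := by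
    have := ((hasDerivAt_pow 4 x).const_mul 14).const_add 1
    simpa using this
  have h := hn.div hd (by positivity)
  have e : ((3 * x ^ 2 * (7 + 8 * x ^ 4) + x ^ 3 * (8 * (4 * x ^ 3))) * (1 + 14 * x ^ 4)
      - x ^ 3 * (7 + 8 * x ^ 4) * (14 * (4 * x ^ 3))) / (1 + 14 * x ^ 4) ^ 2 = 7 / 9 := by
    rw [show x ^ 3 * (8 * (4 * x ^ 3)) = 32 * x ^ 6 by ring,
      show x ^ 3 * (7 + 8 * x ^ 4) * (14 * (4 * x ^ 3)) = 56 * x ^ 6 * (7 + 8 * x ^ 4) by ring,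
      h2, h4, h6]
    norm_num
  rw [e] at h
  exact h
end

section
/- The number of codewords of G of each Hamming weight is: weight 0: 1; weight 7: 253; weight 8: 506; weight 11: 1288; weight 12: 1288; weight 15: 506; weight 16: 253; weight 23: 1; and there are no codewords of any other weight. In particular |G| = 2¹² = 4096. -/
open Polynomial

/-- Hamming weight: the number of coordinates equal to 1. -/
def hw {n : ℕ} (a : Fin n → ZMod 2) : ℕ :=
  (Finset.univ.filter (fun i => a i = 1)).card

/-- The polynomial associated to a length-23 binary vector. -/
noncomputable def codePoly (c : Fin 23 → ZMod 2) : Polynomial (ZMod 2) :=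
  ∑ i : Fin 23, Polynomial.C (c i) * Polynomial.X ^ (i : ℕ)

/-- The generator polynomial of the binary [23,12,7] Golay code. -/
noncomputable def golayGen : Polynomial (ZMod 2) :=
  X ^ 11 + X ^ 10 + X ^ 6 + X ^ 5 + X ^ 4 + X ^ 2 + 1

/-- The binary cyclic [23,12,7] Golay code: vectors whose associated polynomial
is divisible by the generator polynomial modulo `X²³ - 1`. -/
def golay : Set (Fin 23 → ZMod 2) :=
  {c | ∃ q r : Polynomial (ZMod 2),
    codePoly c = golayGen * q + (X ^ 23 - 1) * r}

namespace GolayAux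

/-- bit vector of a natural number -/
def bv (n v : ℕ) : Fin n → ZMod 2 := fun i => ((v / 2 ^ (i : ℕ) % 2 : ℕ) : ZMod 2)

def sel (m j : ℕ) : ℕ := Nat.mul (Nat.mod (Nat.shiftRight m j) 2) (Nat.shiftLeft 3189 j)

def encRec (m : ℕ) : ℕ → ℕ
  | 0 => 0
  | j + 1 => Nat.xor (encRec m j) (sel m j)

def wtRec (v : ℕ) : ℕ → ℕ
  | 0 => 0
  | j + 1 => Nat.add (wtRec v j) (Nat.mod (Nat.shiftRight v j) 2)

def wt (m : ℕ) : ℕ := wtRec (encRec m 12) 23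

def cnt (k : ℕ) : ℕ → ℕ → ℕ
  | 0, b => cond (Nat.beq (wt b) k) 1 0
  | d + 1, b => Nat.add (cnt k d b) (cnt k d (Nat.add b (Nat.pow 2 d)))

theorem cnt_eq (k d b : ℕ) :
    cnt k d b = ((Finset.Ico b (b + 2 ^ d)).filter (fun m => wt m = k)).card := by
  induction d generalizing b with
  | zero =>
    rw [cnt, pow_zero, Nat.Ico_succ_singleton, Finset.filter_singleton]
    by_cases h : wt b = k
    · simp [h]
    · have : Nat.beq (wt b) k = false := by
        rw [← Bool.not_eq_true, Nat.beq_eq]; exact h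
      simp [h, this]
  | succ d ih =>
    have e : Finset.Ico b (b + 2 ^ (d + 1)) =
        Finset.Ico b (b + 2 ^ d) ∪ Finset.Ico (b + 2 ^ d) (b + 2 ^ d + 2 ^ d) := by
      rw [Finset.Ico_union_Ico_eq_Ico (Nat.le_add_right _ _) (Nat.le_add_right _ _)]
      congr 1; rw [pow_succ]; ring
    have hd : Disjoint (Finset.Ico b (b + 2 ^ d)) (Finset.Ico (b + 2 ^ d) (b + 2 ^ d + 2 ^ d)) :=
      Finset.Ico_disjoint_Ico_consecutive _ _ _
    rw [e, Finset.filter_union, Finset.card_union_of_disjoint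
      (Finset.disjoint_filter_filter hd), ← ih, ← ih]
    rfl

def big : ℕ → ℕ → ℕ
  | 0, b => Nat.pow 8192 (wt b)
  | d + 1, b => Nat.add (big d b) (big d (Nat.add b (Nat.pow 2 d)))

theorem big_eq (d b : ℕ) : big d b = ∑ m ∈ Finset.Ico b (b + 2 ^ d), 8192 ^ wt m := by
  induction d generalizing b with
  | zero =>
    rw [big, pow_zero, Nat.Ico_succ_singleton, Finset.sum_singleton]
    rfl
  | succ d ih =>
    have e : b + 2 ^ (d + 1) = b + 2 ^ d + 2 ^ d := by rw [pow_succ]; ring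
    rw [e, ← Finset.sum_Ico_consecutive _ (Nat.le_add_right b (2 ^ d)) (Nat.le_add_right _ _),
      ← ih, ← ih]
    rfl

theorem wtRec_le (v n : ℕ) : wtRec v n ≤ n := by
  induction n with
  | zero => exact le_rfl
  | succ n ih =>
    exact Nat.add_le_add ih (Nat.le_of_lt_succ (Nat.mod_lt _ (by norm_num)))

theorem big_cnt : big 12 0 = ∑ k ∈ Finset.range 24, cnt k 12 0 * 8192 ^ k := by
  rw [big_eq, ← Finset.sum_fiberwise_of_maps_to (t := Finset.range 24) (g := wt)
    (fun m _ => Finset.mem_range.2 (Nat.lt_succ_of_le (wtRec_le _ 23)))]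
  refine Finset.sum_congr rfl fun k _ => ?_
  rw [cnt_eq, ← smul_eq_mul, ← Finset.sum_const]
  exact Finset.sum_congr rfl fun m hm => by rw [(Finset.mem_filter.1 hm).2]

theorem cnt_lt (k : ℕ) : cnt k 12 0 < 8192 := by
  rw [cnt_eq]
  exact (Finset.card_filter_le _ _).trans_lt (by simp)

theorem big_val : big 12 0 = Nat.ofDigits 8192 [1, 0, 0, 0, 0, 0, 0, 253, 506, 0, 0, 1288, 1288, 0, 0, 506, 253, 0, 0, 0, 0, 0, 0, 1] := by
  decide +kernel

theorem cnt_list : (List.range 24).map (fun k => cnt k 12 0) =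
    [1, 0, 0, 0, 0, 0, 0, 253, 506, 0, 0, 1288, 1288, 0, 0, 506, 253, 0, 0, 0, 0, 0, 0, 1] := by
  apply Nat.ofDigits_inj_of_len_eq (b := 8192) (by norm_num) (by simp)
  · intro l hl
    obtain ⟨k, _, rfl⟩ := List.mem_map.1 hl
    exact cnt_lt k
  · simp
  · rw [← big_val, big_cnt]
    have h : ∀ (f : ℕ → ℕ) (n : ℕ), Nat.ofDigits 8192 ((List.range n).map f) =
        ∑ k ∈ Finset.range n, f k * 8192 ^ k := by
      intro f n
      induction n with
      | zero => simp
      | succ n ih =>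
        rw [List.range_succ, List.map_append, Nat.ofDigits_append, ih, Finset.sum_range_succ]
        simp [mul_comm]
    exact h _ _

theorem cnt_get (k : ℕ) (hk : k < 24) : cnt k 12 0 =
    [1, 0, 0, 0, 0, 0, 0, 253, 506, 0, 0, 1288, 1288, 0, 0, 506, 253, 0, 0, 0, 0, 0, 0, 1].getD k 0 := by
  rw [← cnt_list]
  simp [List.getD, hk]

theorem cnt0 : cnt 0 12 0 = 1 := cnt_get 0 (by norm_num)
theorem cnt7 : cnt 7 12 0 = 253 := cnt_get 7 (by norm_num)
theorem cnt8 : cnt 8 12 0 = 506 := cnt_get 8 (by norm_num)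
theorem cnt11 : cnt 11 12 0 = 1288 := cnt_get 11 (by norm_num)
theorem cnt12 : cnt 12 12 0 = 1288 := cnt_get 12 (by norm_num)
theorem cnt15 : cnt 15 12 0 = 506 := cnt_get 15 (by norm_num)
theorem cnt16 : cnt 16 12 0 = 253 := cnt_get 16 (by norm_num)
theorem cnt23 : cnt 23 12 0 = 1 := cnt_get 23 (by norm_num)

theorem bv_eq (n v : ℕ) (i : Fin n) : bv n v i = if v.testBit i then 1 else 0 := by
  rw [bv, Nat.testBit_eq_decide_div_mod_eq]
  rcases Nat.mod_two_eq_zero_or_one (v / 2 ^ (i : ℕ)) with h | h <;> simp [h]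

theorem bv_xor (n a b : ℕ) : bv n (Nat.xor a b) = bv n a + bv n b := by
  funext i
  change bv n (a ^^^ b) i = _
  rw [Pi.add_apply, bv_eq, bv_eq, bv_eq, Nat.testBit_xor]
  cases a.testBit i <;> cases b.testBit i <;> simp
  decide

theorem bv_sel (m : ℕ) (j : Fin 12) :
    bv 23 (sel m j) = bv 12 m j • bv 23 (Nat.shiftLeft 3189 j) := by
  have h : sel m j = (m / 2 ^ (j : ℕ) % 2) * (Nat.shiftLeft 3189 j) := by
    change (m >>> (j : ℕ) % 2) * _ = _
    rw [Nat.shiftRight_eq_div_pow]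
  rw [h]
  funext i
  rw [Pi.smul_apply, smul_eq_mul, bv, bv, bv]
  rcases Nat.mod_two_eq_zero_or_one (m / 2 ^ (j : ℕ)) with h | h <;> simp [h]

theorem hw_bv (v n : ℕ) : hw (bv n v) = wtRec v n := by
  have h : ∀ n, wtRec v n = ∑ i ∈ Finset.range n, (if v.testBit i then 1 else 0) := by
    intro n
    induction n with
    | zero => rfl
    | succ n ih =>
      rw [Finset.sum_range_succ, ← ih, wtRec]
      change wtRec v n + (v >>> n) % 2 = _
      rw [Nat.shiftRight_eq_div_pow, Nat.testBit_eq_decide_div_mod_eq]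
      rcases Nat.mod_two_eq_zero_or_one (v / 2 ^ n) with h | h <;> simp [h]
  rw [h, hw, Finset.card_filter, ← Fin.sum_univ_eq_sum_range (fun i => if v.testBit i then 1 else 0)]
  apply Finset.sum_congr rfl
  intro i _
  rw [bv_eq]
  cases v.testBit i <;> simp

def enc (u : Fin 12 → ZMod 2) : Fin 23 → ZMod 2 :=
  ∑ j : Fin 12, u j • bv 23 (Nat.shiftLeft 3189 j)

theorem enc_bv (m : ℕ) : enc (bv 12 m) = bv 23 (encRec m 12) := by
  have h0 : bv 23 0 = 0 := by funext i; simp [bv]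
  have h : ∀ n, bv 23 (encRec m n) = ∑ j ∈ Finset.range n, bv 23 (sel m j) := by
    intro n
    induction n with
    | zero => simpa [encRec] using h0
    | succ n ih => rw [Finset.sum_range_succ, ← ih, encRec, bv_xor]
  rw [h, enc, ← Fin.sum_univ_eq_sum_range (fun j => bv 23 (sel m j))]
  exact Finset.sum_congr rfl fun j _ => (bv_sel m j).symm

noncomputable def msg (u : Fin 12 → ZMod 2) : Polynomial (ZMod 2) :=
  ∑ j : Fin 12, C (u j) * X ^ (j : ℕ)

theorem msg_coeff (u : Fin 12 → ZMod 2) (j : Fin 12) : (msg u).coeff j = u j := by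
  simp [msg, coeff_X_pow, Fin.val_inj]

theorem codePoly_coeff (c : Fin 23 → ZMod 2) (j : Fin 23) : (codePoly c).coeff j = c j := by
  simp [codePoly, coeff_X_pow, Fin.val_inj]

theorem codePoly_inj {a b : Fin 23 → ZMod 2} (h : codePoly a = codePoly b) : a = b := by
  funext j; rw [← codePoly_coeff a, h, codePoly_coeff]

noncomputable def P (n v : ℕ) : Polynomial (ZMod 2) :=
  ∑ i ∈ Finset.range n, C (((v / 2 ^ i % 2 : ℕ)) : ZMod 2) * X ^ i

theorem P_double (n v : ℕ) : P (n + 1) (v * 2) = P n v * X := by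
  rw [P, P, Finset.sum_range_succ', Finset.sum_mul]
  have h : v * 2 / 2 ^ 0 % 2 = 0 := by simp
  rw [h, Nat.cast_zero, C_0, zero_mul, add_zero]
  refine Finset.sum_congr rfl fun i _ => ?_
  rw [pow_succ 2 i, Nat.mul_div_mul_right _ _ (by norm_num), pow_succ, mul_assoc]

theorem P_ext (n d v : ℕ) (h : v < 2 ^ n) : P (n + d) v = P n v := by
  induction d with
  | zero => rfl
  | succ d ih =>
    rw [← ih, ← add_assoc, P, Finset.sum_range_succ, ← P]
    have : v / 2 ^ (n + d) = 0 := Nat.div_eq_of_lt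
      (h.trans_le (Nat.pow_le_pow_right (by norm_num) (Nat.le_add_right _ _)))
    simp [this]

theorem P_gen : P 12 3189 = golayGen := by
  simp only [P, golayGen, Finset.sum_range_succ, Finset.sum_range_zero]
  norm_num
  ring

theorem P_shift (j : ℕ) : P (12 + j) (3189 * 2 ^ j) = golayGen * X ^ j := by
  induction j with
  | zero => simpa using P_gen
  | succ j ih => rw [pow_succ, ← mul_assoc, ← add_assoc, P_double, ih, pow_succ, mul_assoc]

theorem codePoly_row (j : Fin 12) :
    codePoly (bv 23 (Nat.shiftLeft 3189 j)) = golayGen * X ^ (j : ℕ) := by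
  have h : Nat.shiftLeft 3189 j = 3189 * 2 ^ (j : ℕ) := Nat.shiftLeft_eq _ _
  have h1 : codePoly (bv 23 (3189 * 2 ^ (j : ℕ))) = P 23 (3189 * 2 ^ (j : ℕ)) := by
    rw [P, ← Fin.sum_univ_eq_sum_range
      (fun i => C (((3189 * 2 ^ (j : ℕ) / 2 ^ i % 2 : ℕ)) : ZMod 2) * X ^ i)]
    rfl
  have h2 : (23 : ℕ) = 12 + j + (11 - j) := by omega
  rw [h, h1, ← P_shift]
  rw [h2]
  refine P_ext _ _ _ ?_
  rw [pow_add]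
  exact Nat.mul_lt_mul_of_pos_right (by norm_num) (by positivity)

theorem codePoly_enc (u : Fin 12 → ZMod 2) : codePoly (enc u) = golayGen * msg u := by
  rw [msg, Finset.mul_sum]
  have : codePoly (enc u) =
      ∑ j : Fin 12, C (u j) * codePoly (bv 23 (Nat.shiftLeft 3189 j)) := by
    simp only [codePoly, enc, Finset.sum_apply, Pi.smul_apply, smul_eq_mul, map_sum,
      Finset.sum_mul, Finset.mul_sum, C_mul]
    rw [Finset.sum_comm]
    simp only [mul_assoc]
  rw [this]
  refine Finset.sum_congr rfl fun j _ => ?_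
  rw [codePoly_row]; ring

theorem gen_dvd : golayGen ∣ (X ^ 23 - 1 : Polynomial (ZMod 2)) := by
  have h2 : (2 : Polynomial (ZMod 2)) = 0 := CharTwo.two_eq_zero
  refine ⟨1 + X^2 + X^5 + X^8 + X^9 + X^10 + X^11 + X^12, ?_⟩
  rw [golayGen]
  linear_combination (-(1 + X^2 + X^4 + X^5 + X^6 + X^7 + X^8 + X^9 + 2*X^10 + 2*X^11
    + 2*X^12 + 2*X^13 + 2*X^14 + 2*X^15 + 2*X^16 + X^17 + X^18 + X^19 + X^20 + X^21
    + X^22)) * h2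

theorem gen_natDegree : golayGen.natDegree = 11 := by
  rw [golayGen]; compute_degree!

theorem gen_ne : golayGen ≠ 0 := by
  intro h
  have := gen_natDegree
  rw [h] at this
  simp at this

theorem codePoly_natDegree (c : Fin 23 → ZMod 2) : (codePoly c).natDegree ≤ 22 := by
  rw [codePoly]
  refine natDegree_sum_le_of_forall_le _ _ fun i _ => ?_
  exact (natDegree_C_mul_X_pow_le _ _).trans (by omega)

theorem mem_golay (c : Fin 23 → ZMod 2) : c ∈ golay ↔ ∃ u, enc u = c := by
  constructor
  · rintro ⟨q, r, h⟩
    have hd : golayGen ∣ codePoly c := by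
      rw [h]
      exact dvd_add (dvd_mul_right _ _) (gen_dvd.mul_right _)
    obtain ⟨p, hp⟩ := hd
    have hdeg : p.natDegree < 12 := by
      by_cases h0 : p = 0
      · simp [h0]
      · have h1 := codePoly_natDegree c
        rw [hp, natDegree_mul gen_ne h0, gen_natDegree] at h1
        omega
    refine ⟨fun j => p.coeff j, codePoly_inj ?_⟩
    have hm : msg (fun j => p.coeff j) = p := by
      rw [msg, Fin.sum_univ_eq_sum_range (fun j => C (p.coeff j) * X ^ j)]
      exact (as_sum_range_C_mul_X_pow' p hdeg).symm
    rw [codePoly_enc, hp, hm]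
  · rintro ⟨u, rfl⟩
    exact ⟨msg u, 0, by rw [codePoly_enc]; ring⟩

theorem enc_inj : Function.Injective enc := by
  intro u v h
  have h1 : golayGen * msg u = golayGen * msg v := by
    rw [← codePoly_enc, ← codePoly_enc, h]
  have h2 := mul_left_cancel₀ gen_ne h1
  funext j
  rw [← msg_coeff u, h2, msg_coeff]

def e (m : Fin 4096) : Fin 12 → ZMod 2 := bv 12 m

theorem e_inj : Function.Injective e := by
  intro a b h
  apply Fin.ext
  apply Nat.eq_of_testBit_eq
  intro i
  by_cases hi : i < 12
  · have := congrFun h ⟨i, hi⟩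
    rw [e, e, bv_eq, bv_eq] at this
    dsimp only at this
    revert this
    cases (a : ℕ).testBit i <;> cases (b : ℕ).testBit i <;> simp
  · have hp : 2 ^ 12 ≤ 2 ^ i := Nat.pow_le_pow_right (by norm_num) (by omega)
    rw [Nat.testBit_lt_two_pow (by omega), Nat.testBit_lt_two_pow (by omega)]

theorem e_bij : Function.Bijective e :=
  (Fintype.bijective_iff_injective_and_card e).2 ⟨e_inj, by simp [ZMod.card]⟩

theorem golay_eq : golay = Set.range (fun m : Fin 4096 => enc (e m)) := by
  ext c
  rw [mem_golay]
  constructor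
  · rintro ⟨u, rfl⟩
    obtain ⟨m, rfl⟩ := e_bij.2 u
    exact ⟨m, rfl⟩
  · rintro ⟨m, rfl⟩
    exact ⟨_, rfl⟩

theorem inj : Function.Injective (fun m : Fin 4096 => enc (e m)) := enc_inj.comp e_inj

theorem hw_enc (m : Fin 4096) : hw (enc (e m)) = wt m := by
  rw [e, enc_bv, hw_bv, wt]

theorem ncard_eq (k : ℕ) : {c ∈ golay | hw c = k}.ncard = cnt k 12 0 := by
  have h : {c ∈ golay | hw c = k} =
      (fun m : Fin 4096 => enc (e m)) '' {m : Fin 4096 | wt m = k} := by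
    ext c
    rw [golay_eq]
    constructor
    · rintro ⟨⟨m, rfl⟩, h⟩
      exact ⟨m, (hw_enc m).symm.trans h, rfl⟩
    · rintro ⟨m, h, rfl⟩
      exact ⟨⟨m, rfl⟩, (hw_enc m).trans h⟩
  rw [h, Set.ncard_image_of_injective _ inj, cnt_eq,
    ← Set.ncard_image_of_injective _ Fin.val_injective, ← Set.ncard_coe_finset]
  congr 1
  ext m
  simp only [Set.mem_image, Set.mem_ofPred_eq, Finset.coe_filter, Finset.mem_Ico]
  constructor
  · rintro ⟨a, h, rfl⟩
    exact ⟨⟨Nat.zero_le _, by have := a.2; omega⟩, h⟩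
  · rintro ⟨⟨_, h⟩, h'⟩
    exact ⟨⟨m, by omega⟩, h', rfl⟩

theorem golay_card : golay.ncard = 4096 := by
  rw [golay_eq, ← Set.image_univ, Set.ncard_image_of_injective _ inj, Set.ncard_univ]
  simp

theorem cnt_other (k : ℕ) (hk : k ∉ ({0, 7, 8, 11, 12, 15, 16, 23} : Finset ℕ)) :
    cnt k 12 0 = 0 := by
  have key : ∑ j ∈ ({0, 7, 8, 11, 12, 15, 16, 23} : Finset ℕ), cnt j 12 0 = 4096 := by
    simp [cnt0, cnt7, cnt8, cnt11, cnt12, cnt15, cnt16, cnt23]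
  have tot : ∑ j ∈ insert k ({0, 7, 8, 11, 12, 15, 16, 23} : Finset ℕ), cnt j 12 0 ≤ 4096 := by
    simp only [cnt_eq]
    rw [← Finset.card_biUnion]
    · refine (Finset.card_le_card (t := Finset.Ico 0 (0 + 2 ^ 12)) ?_).trans (by simp)
      intro x hx
      simp only [Finset.mem_biUnion, Finset.mem_filter] at hx
      obtain ⟨_, _, h, _⟩ := hx
      exact h
    · intro i _ j _ hij
      refine Finset.disjoint_left.2 ?_
      intro x hx hy
      exact hij ((Finset.mem_filter.1 hx).2.symm.trans (Finset.mem_filter.1 hy).2)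
  rw [Finset.sum_insert hk, key] at tot
  omega

end GolayAux

theorem stmt_12 :
    {c ∈ golay | hw c = 0}.ncard = 1 ∧
    {c ∈ golay | hw c = 7}.ncard = 253 ∧
    {c ∈ golay | hw c = 8}.ncard = 506 ∧
    {c ∈ golay | hw c = 11}.ncard = 1288 ∧
    {c ∈ golay | hw c = 12}.ncard = 1288 ∧
    {c ∈ golay | hw c = 15}.ncard = 506 ∧
    {c ∈ golay | hw c = 16}.ncard = 253 ∧
    {c ∈ golay | hw c = 23}.ncard = 1 ∧
    (∀ k : ℕ, k ∉ ({0, 7, 8, 11, 12, 15, 16, 23} : Set ℕ) →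
      {c ∈ golay | hw c = k}.ncard = 0) ∧
    golay.ncard = 4096 := by
  simp only [GolayAux.ncard_eq]
  refine ⟨GolayAux.cnt0, GolayAux.cnt7, GolayAux.cnt8, GolayAux.cnt11, GolayAux.cnt12, GolayAux.cnt15, GolayAux.cnt16, GolayAux.cnt23, ?_, GolayAux.golay_card⟩
  intro k hk
  exact GolayAux.cnt_other k (by simpa using hk)
end

section
/- The number of ordered pairs (a, b) ∈ G × G such that a has Hamming weight 8, b has Hamming weight 8, and a + b has Hamming weight 8, equals 106260. -/
open Polynomial

def gW : ℕ := 0x6161064110800100169421962961140910942104612000000001000092040100000420000000100000010041100021900101966002040100000021140120000900000100000000140000000010042100200004000000010000000000000000100100000000040000020001000161004116862000010190002001000010042100000000000000149001010040000021000000000000040100000020000000000000000000000000001000000000000000000000000120000000000000000001000000000010040000020461000101000000800000010000000001000000000000000001000100001400200600100001002001146910042101108021060000000992940106616196146129000010042100200004001094014116802100016100100100006000042100020001000000004100002000010190962001140010042100000006411080010000002100000000000000000400000000000100000000010000042000290110000001000010000000010100600204010016942114012000146129966910042100020461960101904100802100010000900001146016042100029401000100000000200000100001002001140010040001108021066161006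9169421002961149001010040168621006101000000040100160420140129909661019641108621091000210620611469169421140120969661610669929468

def gL : List ℕ := [3, 5, 6, 10, 12, 15, 17, 20, 23, 24, 27, 29, 30, 33, 34, 40, 45, 46, 48, 53, 54, 57, 58, 60, 63,
65, 66, 68, 71, 77, 80, 90, 92, 96, 101, 106, 108, 111, 113, 114, 116, 120, 123, 125, 126, 130,
132, 136, 141, 142, 149, 153, 154, 160, 165, 180, 184, 187, 192, 197, 201, 202, 207, 212, 216,
222, 225, 226, 228, 231, 232, 240, 245, 246, 249, 250, 252, 255, 260, 263, 264, 267, 269, 272,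
282, 284, 293, 298, 305, 306, 308, 320, 330, 360, 368, 373, 374, 384, 389, 393, 394, 399, 401,
402, 404, 414, 424, 432, 444, 447, 450, 452, 456, 461, 462, 464, 467, 469, 480, 485, 490, 492,
495, 497, 498, 500, 504, 507, 509, 510, 520, 525, 526, 528, 533, 534, 537, 538, 544, 549, 559,
564, 568, 586, 596, 610, 612, 616, 629, 640, 660, 685, 720, 736, 746, 748, 751, 753, 768, 773,
778, 785, 786, 788, 797, 798, 802, 804, 808, 828, 831, 848, 864, 869, 879, 888, 894, 900, 903,
904, 912, 921, 922, 924, 927, 928, 933, 934, 938, 945, 960, 965, 970, 980, 984, 987, 989, 990,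
993, 994, 996, 999, 1000, 1003, 1005, 1008, 1013, 1014, 1018, 1020, 1037, 1040, 1050, 1052,
1056, 1061, 1066, 1068, 1071, 1073, 1074, 1076, 1088, 1098, 1105, 1117, 1118, 1128, 1136, 1172,
1192, 1220, 1224, 1232, 1235, 1237, 1253, 1258, 1280, 1320, 1370, 1440, 1445, 1472, 1487, 1492,
1496, 1502, 1505, 1506, 1536, 1541, 1546, 1556, 1570, 1572, 1576, 1589, 1593, 1594, 1596, 1599,
1604, 1607, 1608, 1616, 1637, 1656, 1662, 1696, 1713, 1728, 1733, 1738, 1757, 1758, 1776, 1788,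
1800, 1805, 1806, 1808, 1824, 1829, 1839, 1841, 1842, 1844, 1848, 1854, 1856, 1866, 1868, 1871,
1876, 1890, 1909, 1920, 1925, 1930, 1940, 1960, 1963, 1965, 1968, 1973, 1974, 1978, 1980, 1985,
1986, 1988, 1991, 1992, 1997, 1998, 2000, 2005, 2006, 2009, 2010, 2016, 2026, 2028, 2031, 2033,
2036, 2039, 2040, 2043, 2073, 2074, 2080, 2085, 2095, 2100, 2104, 2112, 2117, 2122, 2132, 2136,
2139, 2141, 2142, 2146, 2148, 2152, 2165, 2176, 2196, 2209, 2210, 2221, 2234, 2236, 2256, 2272,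
2344, 2384, 2415, 2440, 2448, 2464, 2469, 2470, 2474, 2481, 2506, 2516, 2560, 2637, 2640, 2740,
2853, 2880, 2890, 2944, 2949, 2974, 2984, 2992, 3004, 3007, 3010, 3012, 3072, 3077, 3082, 3092,
3112, 3125, 3140, 3143, 3144, 3152, 3173, 3177, 3178, 3183, 3185, 3186, 3188, 3192, 3198, 3208,
3213, 3214, 3216, 3232, 3249, 3274, 3312, 3324, 3392, 3426, 3445, 3456, 3461, 3466, 3476, 3514,
3516, 3552, 3576, 3579, 3597, 3600, 3610, 3612, 3616, 3621, 3648, 3658, 3665, 3677, 3678, 3681,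
3682, 3684, 3687, 3688, 3696, 3708, 3711, 3712, 3717, 3732, 3736, 3742, 3752, 3780, 3813, 3818,
3840, 3850, 3857, 3860, 3863, 3880, 3917, 3920, 3925, 3926, 3930, 3936, 3941, 3946, 3948, 3951,
3956, 3960, 3963, 3970, 3972, 3976, 3981, 3982, 3984, 3987, 3989, 3993, 3994, 3996, 3999, 4000,
4005, 4010, 4012, 4015, 4017, 4018, 4020, 4032, 4047, 4052, 4056, 4062, 4065, 4066, 4072, 4077,
4078, 4080, 4085, 4086]

/-- binary expansion as a vector -/
def gvec (n : ℕ) (x : ℕ) : Fin n → ZMod 2 := fun k => if x.testBit k then 1 else 0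

def gE : ℕ → ℕ → ℕ
  | 0, _ => 0
  | j + 1, n => Nat.xor (gE j n) (Nat.mul (Nat.mod (Nat.shiftRight n j) 2) (Nat.shiftLeft 3189 j))

def gpop : ℕ → ℕ → ℕ
  | 0, _ => 0
  | j + 1, n => Nat.add (gpop j n) (Nat.mod (Nat.shiftRight n j) 2)

def gbit (x : ℕ) : Bool := Nat.beq (Nat.land (Nat.shiftRight gW x) 1) 1

def gcnt (a : ℕ) : List ℕ → ℕ
  | [] => 0
  | b :: l => Nat.add (Nat.land (Nat.shiftRight gW (Nat.xor a b)) 1) (gcnt a l)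

set_option linter.constructorNameAsVariable false

theorem gW_spec : ((List.range 4096).all fun n =>
    (Nat.beq (gpop 23 (gE 12 n)) 8) == gbit n) = true := by
  decide +kernel

theorem gL_spec : (List.range 4096).filter gbit = gL := by
  decide +kernel

theorem gcount : (gL.map fun a => gcnt a gL).sum = 106260 := by
  decide +kernel

theorem gvec_xor (n a b : ℕ) : gvec n (a ^^^ b) = gvec n a + gvec n b := by
  funext k
  simp only [gvec, Nat.testBit_xor, Pi.add_apply]
  cases a.testBit k <;> cases b.testBit k <;> decide

theorem gpop_spec (x : ℕ) (n : ℕ) : hw (gvec n x) = gpop n x := by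
  induction n with
  | zero => simp [hw, gpop]
  | succ n ih =>
    have h : ∀ m, hw (gvec m x) = ∑ i : Fin m, if x.testBit i then 1 else 0 := by
      intro m
      unfold hw
      rw [Finset.card_filter]
      refine Finset.sum_congr rfl fun i _ => ?_
      unfold gvec
      cases x.testBit i <;> simp
    rw [h, Fin.sum_univ_castSucc]
    rw [h] at ih
    simp only [Fin.val_castSucc, Fin.val_last, gpop]
    rw [ih]
    show _ + _ = _ + (x >>> n) % 2
    congr 1
    simp only [Nat.testBit_eq_decide_div_mod_eq, Nat.shiftRight_eq_div_pow]
    rcases Nat.mod_two_eq_zero_or_one (x / 2 ^ n) with h | h <;> simp [h]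

def genc (q : Fin 12 → ZMod 2) : Fin 23 → ZMod 2 :=
  fun k => ∑ j : Fin 12, q j * gvec 23 (3189 <<< (j : ℕ)) k

theorem genc_add (a b) : genc (a + b) = genc a + genc b := by
  funext k
  simp [genc, add_mul, Finset.sum_add_distrib]

theorem gE_spec (n : ℕ) : genc (gvec 12 n) = gvec 23 (gE 12 n) := by
  have h : ∀ m, gvec 23 (gE m n) = fun k => ∑ j : Fin m, gvec m n j * gvec 23 (3189 <<< (j : ℕ)) k := by
    intro m
    induction m with
    | zero => funext k; simp [gE, gvec]
    | succ m ih =>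
      have e : gE (m + 1) n = gE m n ^^^ ((n >>> m) % 2 * (3189 <<< m)) := rfl
      rw [e, gvec_xor, ih]
      funext k
      rw [Pi.add_apply, Fin.sum_univ_castSucc]
      simp only [Fin.val_castSucc, Fin.val_last]
      congr 1
      have e2 : gvec (m + 1) n (Fin.last m) = if (n >>> m) % 2 = 1 then 1 else 0 := by
        simp only [gvec, Fin.val_last, Nat.testBit_eq_decide_div_mod_eq, Nat.shiftRight_eq_div_pow]
        simp
      rw [e2]
      rcases Nat.mod_two_eq_zero_or_one (n >>> m) with h | h
      · simp [h, gvec]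
      · simp [h]
  rw [h 12]
  rfl

theorem codePoly_genc (q : Fin 12 → ZMod 2) :
    codePoly (genc q) = golayGen * ∑ j : Fin 12, C (q j) * X ^ (j : ℕ) := by
  have h1 : codePoly (genc q) = ∑ j : Fin 12, C (q j) * codePoly (gvec 23 (3189 <<< (j : ℕ))) := by
    simp only [codePoly, genc, map_sum, map_mul, Finset.sum_mul, Finset.mul_sum]
    rw [Finset.sum_comm]
    simp only [mul_assoc]
  rw [h1, Finset.mul_sum]
  refine Finset.sum_congr rfl fun j _ => ?_
  have h2 : codePoly (gvec 23 (3189 <<< (j : ℕ))) = golayGen * X ^ (j : ℕ) := by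
    fin_cases j <;>
    · simp [codePoly, gvec, Fin.sum_univ_succ, golayGen, Nat.testBit, Nat.shiftRight_eq_div_pow, Fin.val_succ]
      ring
  rw [h2]; ring

theorem codePoly_coeff (c : Fin 23 → ZMod 2) (k : Fin 23) : (codePoly c).coeff k = c k := by
  simp [codePoly, Polynomial.coeff_X_pow, Fin.val_inj]

theorem codePoly_inj : Function.Injective codePoly := by
  intro a b h
  funext k
  rw [← codePoly_coeff a, h, codePoly_coeff]

theorem golayGen_monic : golayGen.Monic ∧ golayGen.natDegree = 11 := by
  have h : golayGen.natDegree = 11 := by unfold golayGen; compute_degree!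
  refine ⟨?_, h⟩
  unfold Monic leadingCoeff
  rw [h]
  unfold golayGen
  simp [coeff_X_pow, coeff_one]

theorem golayGen_dvd : golayGen ∣ (X ^ 23 - 1 : (ZMod 2)[X]) := by
  refine ⟨X ^ 12 + X ^ 11 + X ^ 10 + X ^ 9 + X ^ 8 + X ^ 5 + X ^ 2 + 1, ?_⟩
  have h2 : (2 : (ZMod 2)[X]) = 0 := CharTwo.two_eq_zero
  unfold golayGen
  ring_nf
  reduce_mod_char
  try ring

theorem genc_inj : Function.Injective genc := by
  intro a b h
  have h' := congrArg codePoly h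
  rw [codePoly_genc, codePoly_genc] at h'
  have := mul_left_cancel₀ golayGen_monic.1.ne_zero h'
  funext k
  have := congrArg (fun p => p.coeff (k : ℕ)) this
  simpa [Polynomial.coeff_X_pow, Fin.val_inj] using this

theorem mem_golay (c) : c ∈ golay ↔ ∃ q, genc q = c := by
  constructor
  · rintro ⟨q, r, h⟩
    obtain ⟨s, hs⟩ := golayGen_dvd
    have h' : codePoly c = golayGen * (q + s * r) := by rw [h, hs]; ring
    generalize q + s * r = Q at h'
    refine ⟨fun j => Q.coeff j, codePoly_inj ?_⟩
    rw [codePoly_genc, h']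
    have hd : Q.natDegree < 12 := by
      by_cases hQ : Q = 0
      · simp [hQ]
      have e := golayGen_monic.1.natDegree_mul' hQ
      rw [← h', golayGen_monic.2] at e
      have : (codePoly c).natDegree ≤ 22 := by
        unfold codePoly
        refine natDegree_sum_le_of_forall_le _ _ fun i _ => ?_
        exact (natDegree_C_mul_X_pow_le _ _).trans (by omega)
      omega
    have hQ := Q.as_sum_range_C_mul_X_pow' hd
    rw [Finset.sum_range] at hQ
    exact congrArg (fun p => golayGen * p) hQ.symm
  · rintro ⟨q, rfl⟩
    exact ⟨∑ j : Fin 12, C (q j) * X ^ (j : ℕ), 0, by rw [codePoly_genc, mul_zero, add_zero]⟩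

theorem gvec_injOn (n : ℕ) : Function.Injective (fun x : Fin (2 ^ n) => gvec n x) := by
  intro a b h
  apply Fin.ext
  apply Nat.eq_of_testBit_eq
  intro i
  by_cases hi : i < n
  · have := congrFun h ⟨i, hi⟩
    simp only [gvec] at this
    cases ha : (a : ℕ).testBit i <;> cases hb : (b : ℕ).testBit i <;> simp_all
  · have hp : 2 ^ n ≤ 2 ^ i := Nat.pow_le_pow_right (by norm_num) (by omega)
    rw [Nat.testBit_lt_two_pow (a.2.trans_le hp), Nat.testBit_lt_two_pow (b.2.trans_le hp)]

theorem gvec_bij (n : ℕ) : Function.Bijective (fun x : Fin (2 ^ n) => gvec n x) := by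
  rw [Fintype.bijective_iff_injective_and_card]
  exact ⟨gvec_injOn n, by simp [ZMod.card]⟩

theorem gbit_spec (n : ℕ) (hn : n < 4096) : hw (genc (gvec 12 n)) = 8 ↔ gbit n = true := by
  rw [gE_spec, gpop_spec]
  have := List.all_eq_true.1 gW_spec n (List.mem_range.2 hn)
  rw [← eq_of_beq this, Nat.beq_eq]

theorem gmem (n : ℕ) : n ∈ gL ↔ n < 4096 ∧ gbit n = true := by
  rw [← gL_spec, List.mem_filter, List.mem_range]

theorem gnodup : gL.Nodup := by
  rw [← gL_spec]
  exact List.nodup_range.filter _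

theorem gcnt_spec (a : ℕ) (l : List ℕ) : gcnt a l = l.countP fun b => gbit (a ^^^ b) := by
  induction l with
  | nil => rfl
  | cons b l ih =>
    have e : gcnt a (b :: l) = ((gW >>> (a ^^^ b)) &&& 1) + gcnt a l := rfl
    have e2 : gbit (a ^^^ b) = Nat.beq ((gW >>> (a ^^^ b)) &&& 1) 1 := rfl
    rw [e, List.countP_cons, ih, e2, Nat.and_one_is_mod, add_comm]
    congr 1
    rcases Nat.mod_two_eq_zero_or_one (gW >>> (a ^^^ b)) with h | h <;> rw [h] <;> rfl

theorem stmt_13 :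
    {p : (Fin 23 → ZMod 2) × (Fin 23 → ZMod 2) |
        p.1 ∈ golay ∧ p.2 ∈ golay ∧
        hw p.1 = 8 ∧ hw p.2 = 8 ∧ hw (p.1 + p.2) = 8}.ncard = 106260 := by
  have key : {p : (Fin 23 → ZMod 2) × (Fin 23 → ZMod 2) |
        p.1 ∈ golay ∧ p.2 ∈ golay ∧
        hw p.1 = 8 ∧ hw p.2 = 8 ∧ hw (p.1 + p.2) = 8} =
      (fun p : ℕ × ℕ => (genc (gvec 12 p.1), genc (gvec 12 p.2))) ''
        (((gL.toFinset ×ˢ gL.toFinset).filter fun p => gbit (p.1 ^^^ p.2) = true : Finset (ℕ × ℕ)) :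
          Set (ℕ × ℕ)) := by
    ext ⟨x, y⟩
    simp only [Set.mem_ofPred_eq, Set.mem_image, Finset.mem_coe, Finset.mem_filter,
      Finset.mem_product, List.mem_toFinset, Prod.exists, Prod.mk.injEq]
    constructor
    · rintro ⟨hx, hy, h1, h2, h3⟩
      obtain ⟨q, rfl⟩ := (mem_golay x).1 hx
      obtain ⟨r, rfl⟩ := (mem_golay y).1 hy
      obtain ⟨⟨a, ha⟩, rfl⟩ := (gvec_bij 12).2 q
      obtain ⟨⟨b, hb⟩, rfl⟩ := (gvec_bij 12).2 r
      have hab := Nat.xor_lt_two_pow ha hb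
      dsimp only at h1 h2 h3
      rw [← genc_add, ← gvec_xor, gbit_spec _ hab] at h3
      rw [gbit_spec _ ha] at h1
      rw [gbit_spec _ hb] at h2
      exact ⟨a, b, ⟨⟨(gmem a).2 ⟨ha, h1⟩, (gmem b).2 ⟨hb, h2⟩⟩, h3⟩, rfl, rfl⟩
    · rintro ⟨a, b, ⟨⟨ha, hb⟩, h3⟩, rfl, rfl⟩
      obtain ⟨ha, h1⟩ := (gmem a).1 ha
      obtain ⟨hb, h2⟩ := (gmem b).1 hb
      have hab : a ^^^ b < 2 ^ 12 := Nat.xor_lt_two_pow (n := 12) ha hb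
      refine ⟨(mem_golay _).2 ⟨_, rfl⟩, (mem_golay _).2 ⟨_, rfl⟩, (gbit_spec _ ha).2 h1,
        (gbit_spec _ hb).2 h2, ?_⟩
      rw [← genc_add, ← gvec_xor, gbit_spec _ hab]
      exact h3
  rw [key, Set.InjOn.ncard_image, Set.ncard_coe_finset]
  · rw [Finset.card_filter, Finset.sum_product, List.sum_toFinset _ gnodup]
    refine Eq.trans ?_ gcount
    refine congrArg List.sum (List.map_congr_left fun a _ => ?_)
    rw [List.sum_toFinset _ gnodup, gcnt_spec]
    generalize gL = l
    induction l with
    | nil => rfl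
    | cons b l ih => rw [List.map_cons, List.sum_cons, ih, List.countP_cons, add_comm]
  · rintro ⟨a, b⟩ h ⟨a', b'⟩ h' e
    simp only [Finset.mem_coe, Finset.mem_filter, Finset.mem_product, List.mem_toFinset,
      gmem] at h h'
    simp only [Prod.mk.injEq] at e
    have h1 := @gvec_injOn 12 ⟨a, h.1.1.1⟩ ⟨a', h'.1.1.1⟩ (genc_inj e.1)
    have h2 := @gvec_injOn 12 ⟨b, h.1.2.1⟩ ⟨b', h'.1.2.1⟩ (genc_inj e.2)
    simp only [Fin.mk.injEq] at h1 h2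
    rw [h1, h2]
end

section
/- There exists a real number x with 0.6 < x < 0.65 such that g(x) = x. (The Golay-code distillation map has a fixed point strictly between the threshold 1/2 and the magic value 1/√2; numerically it lies at x ≈ 0.62292.) -/
/-- The output Bloch coordinate of one round of Golay-code magic state
distillation applied to input Bloch coordinate `x` along the H direction. -/
noncomputable def g (x : ℝ) : ℝ :=
  x ^ 7 * (253 + 1288 * x ^ 4 + 8096 * x ^ 8 + 2048 * x ^ 16) /
    (1 + 1012 * x ^ 8 + 2576 * x ^ 12 + 8096 * x ^ 16)

theorem stmt_16 : ∃ x : ℝ, 0.6 < x ∧ x < 0.65 ∧ g x = x := by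
  have hpos : ∀ x : ℝ, (1 + 1012 * x ^ 8 + 2576 * x ^ 12 + 8096 * x ^ 16) ≠ 0 := by
    intro x
    have h8 : 0 ≤ x ^ 8 := Even.pow_nonneg (by decide) x
    have h12 : 0 ≤ x ^ 12 := Even.pow_nonneg (by decide) x
    have h16 : 0 ≤ x ^ 16 := Even.pow_nonneg (by decide) x
    positivity
  have hc : Continuous (fun x : ℝ => g x - x) := by
    unfold g
    exact (Continuous.div (by fun_prop) (by fun_prop) hpos).sub continuous_id
  have h := intermediate_value_Ioo' (a := (0.6 : ℝ)) (b := 0.65) (by norm_num) hc.continuousOn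
  have h0 : (0 : ℝ) ∈ Set.Ioo (g 0.65 - 0.65) (g 0.6 - 0.6) := by
    unfold g
    constructor <;> norm_num
  obtain ⟨x, hx, hx0⟩ := h h0
  exact ⟨x, hx.1, hx.2, sub_eq_zero.mp hx0⟩
end

section
/- Let n be a natural number and let S be any subgroup of the additive group (Fin n → ZMod 2) (equivalently, a binary linear code of length n). Then ∑_{a ∈ S} ∑_{b ∈ S} 3^{w(a ∧ b)} = ∑_{a ∈ S} ∑_{b ∈ S} 3^{w(a) − w(a ∧ b)}, where a ∧ b denotes the componentwise product and w the Hamming weight. (Equivalently, since w(a) + w(b) − w(a+b) = 2·w(a∧b), the sum ∑_{a,b ∈ S} [ 2·3^{(w(a)+w(b)−w(a+b))/2} − 3^{(w(a)−w(b)+w(a+b))/2} − 3^{(−w(a)+w(b)+w(a+b))/2} ] vanishes; this is the identity showing that the Bloch point (1/2, 0, 1/2) is a fixed point of the distillation procedure for every CSS code with transverse logical X and Z.) -/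
theorem hw_split {n : ℕ} (a b : Fin n → ZMod 2) :
    hw (fun i => a i * (a i + b i)) + hw (fun i => a i * b i) = hw a := by
  unfold hw
  simp only [Finset.card_filter]
  rw [← Finset.sum_add_distrib]
  refine Finset.sum_congr rfl fun i _ => ?_
  generalize a i = x
  generalize b i = y
  revert x y
  decide

open scoped Classical in
theorem stmt_18 (n : ℕ) (S : AddSubgroup (Fin n → ZMod 2)) :
    ∑ a : S, ∑ b : S, (3 : ℕ) ^ hw (fun i => (a : Fin n → ZMod 2) i * (b : Fin n → ZMod 2) i) =
      ∑ a : S, ∑ b : S,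
        (3 : ℕ) ^ (hw (a : Fin n → ZMod 2) -
          hw (fun i => (a : Fin n → ZMod 2) i * (b : Fin n → ZMod 2) i)) := by
  refine Finset.sum_congr rfl fun a _ => ?_
  refine (Fintype.sum_equiv (Equiv.addLeft a) _ _ fun b => ?_).symm
  have h := hw_split (a : Fin n → ZMod 2) (b : Fin n → ZMod 2)
  simp only [Equiv.coe_addLeft, AddSubgroup.coe_add, Pi.add_apply]
  congr 1
  omega
end

section
/- Let α, β ∈ ℂ be nonzero and let t ∈ ℝ with 0 < t < 1. Then it is not the case that both of the vectors (α, t·β) and (t·α, β) in ℂ² are nonzero complex scalar multiples of elements of the set Σ = {(1,0), (0,1), (1,1), (1,−1), (1,i), (1,−i)} of single-qubit stabilizer states. (With t = 2^{−(n−1)/2}, this is the key step in showing that any multi-qubit pure state which is not a stabilizer state can be reduced by postselected Pauli measurements to a single-qubit pure state which is not a Pauli eigenstate.) -/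
open Complex

/-- The six single-qubit stabilizer states (Pauli eigenstates), as vectors in
`ℂ²` up to scalar multiple. -/
def stabStates : Set (ℂ × ℂ) :=
  {(1, 0), (0, 1), (1, 1), (1, -1), (1, I), (1, -I)}

theorem norm_eq_of_stab (x y : ℂ) (hx : x ≠ 0) (hy : y ≠ 0)
    (h : ∃ w ∈ stabStates, ∃ l : ℂ, l ≠ 0 ∧ (x, y) = l • w) : ‖x‖ = ‖y‖ := by
  obtain ⟨w, hw, l, hl, h⟩ := h
  simp only [stabStates, Set.mem_insert_iff, Set.mem_singleton_iff] at hw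
  rcases hw with rfl | rfl | rfl | rfl | rfl | rfl <;>
    simp only [Prod.smul_mk, Prod.mk.injEq, smul_eq_mul] at h <;>
    obtain ⟨rfl, rfl⟩ := h <;> simp_all

theorem stmt_19 (α β : ℂ) (hα : α ≠ 0) (hβ : β ≠ 0) (t : ℝ)
    (ht0 : 0 < t) (ht1 : t < 1) :
    ¬((∃ w ∈ stabStates, ∃ l : ℂ, l ≠ 0 ∧ (α, (t : ℂ) * β) = l • w) ∧
      (∃ w ∈ stabStates, ∃ l : ℂ, l ≠ 0 ∧ ((t : ℂ) * α, β) = l • w)) := by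
  rintro ⟨h1, h2⟩
  have ht : (t : ℂ) ≠ 0 := by exact_mod_cast ht0.ne'
  have e1 := norm_eq_of_stab _ _ hα (mul_ne_zero ht hβ) h1
  have e2 := norm_eq_of_stab _ _ (mul_ne_zero ht hα) hβ h2
  rw [norm_mul, Complex.norm_real, Real.norm_of_nonneg ht0.le] at e1 e2
  have a := norm_pos_iff.mpr hα
  have b := norm_pos_iff.mpr hβ
  nlinarith
end
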